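/- For Lebesgue almost every real number x > 1, the sequence of fractional parts ({x^n})_{n=1}^∞ has Poissonian pair correlations; that is, for every s > 0, lim_{N→∞} (1/N) · #{(m,n) : 1 ≤ m ≠ n ≤ N, ‖x^n − x^m‖ ≤ s/N} = 2s, where ‖·‖ denotes distance to the nearest integer. -/

import Mathlib

open MeasureTheory Filter

open Classical in
/-- Number of pairs `1 ≤ m ≠ n ≤ N` with `‖x^n - x^m‖ ≤ s/N`, where `‖·‖` is the
distance to the nearest integer. -/
noncomputable def pairCount (x s : ℝ) (N : ℕ) : ℕ :=
  ((Finset.Icc 1 N ×ˢ Finset.Icc 1 N).filter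
    (fun p => p.1 ≠ p.2 ∧
      |x ^ p.2 - x ^ p.1 - round (x ^ p.2 - x ^ p.1)| ≤ s / N)).card

namespace PairCorrelation

/-- The distance from a real number to the nearest integer. -/
noncomputable def distInt (y : ℝ) : ℝ := |y - round y|

theorem distInt_le (y : ℝ) (z : ℤ) : distInt y ≤ |y - z| := round_le y z

theorem distInt_nonneg (y : ℝ) : 0 ≤ distInt y := abs_nonneg _

theorem distInt_neg (y : ℝ) : distInt (-y) = distInt y := by
  have key (z : ℝ) : distInt (-z) ≤ distInt z := by
    refine (distInt_le (-z) (-round z)).trans_eq ?_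
    rw [distInt, ← abs_neg]
    push_cast
    ring_nf
  exact le_antisymm (key y) (by simpa using key (-y))

theorem distInt_sub_le (y z : ℝ) : distInt (y - z) ≤ distInt y + distInt z := by
  refine (distInt_le (y - z) (round y - round z)).trans ?_
  push_cast
  rw [show y - z - ((round y : ℝ) - round z) = (y - round y) - (z - round z) by ring]
  exact abs_sub _ _

theorem distInt_eq_abs {y : ℝ} (hy : |y| ≤ 1 / 2) : distInt y = |y| := by
  refine le_antisymm (by simpa using distInt_le y 0) ?_
  by_cases h : round y = 0
  · simp [distInt, h]
  · have h1 : (1 : ℝ) ≤ |(round y : ℝ)| := by exact_mod_cast Int.one_le_abs h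
    have h2 : |(round y : ℝ)| ≤ |y - round y| + |y| := by
      have := abs_sub (y - round y) y
      rw [show y - round y - y = -(round y : ℝ) by ring, abs_neg] at this
      exact this
    rw [distInt]
    linarith

theorem cos_two_pi_mul_eq_cos_distInt (y : ℝ) :
    Real.cos (2 * Real.pi * y) = Real.cos (2 * Real.pi * distInt y) := by
  have h : 2 * Real.pi * distInt y = |2 * Real.pi * y - (round y : ℤ) * (2 * Real.pi)| := by
    rw [distInt, show 2 * Real.pi * y - (round y : ℤ) * (2 * Real.pi)
      = (2 * Real.pi) * (y - round y) by ring, abs_mul, abs_of_pos Real.two_pi_pos]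
  rw [h, Real.cos_abs, Real.cos_sub_int_mul_two_pi]

/-- A smooth function of period one that interpolates between the indicator functions of
`distInt y ≤ a` and of `distInt y ≤ b`. -/
noncomputable def bump (a b y : ℝ) : ℝ :=
  Real.smoothTransition ((Real.cos (2 * Real.pi * y) - Real.cos (2 * Real.pi * b)) /
    (Real.cos (2 * Real.pi * a) - Real.cos (2 * Real.pi * b)))

theorem bump_nonneg (a b y : ℝ) : 0 ≤ bump a b y := Real.smoothTransition.nonneg _

theorem bump_le_one (a b y : ℝ) : bump a b y ≤ 1 := Real.smoothTransition.le_one _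

theorem bump_periodic (a b : ℝ) : Function.Periodic (bump a b) 1 := fun y ↦ by
  rw [bump, mul_add, mul_one, Real.cos_add_two_pi, bump]

theorem contDiff_bump (a b : ℝ) : ContDiff ℝ 1 (bump a b) := by
  unfold bump
  exact Real.smoothTransition.contDiff.comp (by fun_prop)

theorem continuous_bump (a b : ℝ) : Continuous (bump a b) := (contDiff_bump a b).continuous

theorem cos_sub_cos_ge {a b : ℝ} (ha : 0 ≤ a) (hab : a ≤ b) (hb : b ≤ 1 / 4) :
    8 * (b ^ 2 - a ^ 2) ≤ Real.cos (2 * Real.pi * a) - Real.cos (2 * Real.pi * b) := by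
  have hpi := Real.pi_pos
  have h1 := Real.mul_le_sin (x := Real.pi * (a + b))
    (mul_nonneg hpi.le (by linarith)) (by nlinarith)
  have h2 := Real.mul_le_sin (x := Real.pi * (b - a))
    (mul_nonneg hpi.le (by linarith)) (by nlinarith)
  have e (z : ℝ) : 2 / Real.pi * (Real.pi * z) = 2 * z := by field_simp
  rw [e] at h1 h2
  rw [Real.cos_sub_cos, show (2 * Real.pi * a + 2 * Real.pi * b) / 2 = Real.pi * (a + b) by ring,
    show (2 * Real.pi * a - 2 * Real.pi * b) / 2 = -(Real.pi * (b - a)) by ring, Real.sin_neg]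
  nlinarith [mul_le_mul h1 h2 (by linarith) (by linarith)]

theorem bump_eq_one {a b y : ℝ} (ha : 0 ≤ a) (hab : a < b) (hb : b ≤ 1 / 4)
    (hy : distInt y ≤ a) : bump a b y = 1 := by
  have hpi := Real.pi_pos
  have h0 := distInt_nonneg y
  have hpos := cos_sub_cos_ge ha hab.le hb
  refine Real.smoothTransition.one_of_one_le ?_
  rw [one_le_div (by nlinarith), cos_two_pi_mul_eq_cos_distInt y]
  have := Real.cos_le_cos_of_nonneg_of_le_pi (x := 2 * Real.pi * distInt y)
    (y := 2 * Real.pi * a) (by positivity) (by nlinarith) (by gcongr)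
  linarith

theorem bump_eq_zero {a b y : ℝ} (ha : 0 ≤ a) (hab : a < b) (hb : b ≤ 1 / 4)
    (hy : b ≤ distInt y) : bump a b y = 0 := by
  have hpi := Real.pi_pos
  have hpos := cos_sub_cos_ge ha hab.le hb
  have hhalf : distInt y ≤ 1 / 2 := abs_sub_round y
  refine Real.smoothTransition.zero_of_nonpos (div_nonpos_of_nonpos_of_nonneg ?_ (by nlinarith))
  rw [cos_two_pi_mul_eq_cos_distInt y]
  have := Real.cos_le_cos_of_nonneg_of_le_pi (x := 2 * Real.pi * b)
    (y := 2 * Real.pi * distInt y) (by have := ha.trans hab.le; positivity) (by nlinarith)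
    (by gcongr)
  linarith

theorem exists_bound_deriv_smoothTransition :
    ∃ K : ℝ, ∀ t, |deriv Real.smoothTransition t| ≤ K := by
  have hcont : Continuous (deriv Real.smoothTransition) :=
    (Real.smoothTransition.contDiff (n := 1)).continuous_deriv le_rfl
  have hsupp : HasCompactSupport (deriv Real.smoothTransition) := by
    refine HasCompactSupport.intro (isCompact_Icc (a := (0 : ℝ)) (b := 1)) fun t ht ↦ ?_
    rw [Set.mem_Icc, not_and_or, not_le, not_le] at ht
    rcases ht with ht | ht
    · have : Real.smoothTransition =ᶠ[nhds t] fun _ ↦ 0 := by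
        filter_upwards [eventually_lt_nhds ht] with u hu
        exact Real.smoothTransition.zero_of_nonpos hu.le
      rw [this.deriv_eq, deriv_const]
    · have : Real.smoothTransition =ᶠ[nhds t] fun _ ↦ 1 := by
        filter_upwards [eventually_gt_nhds ht] with u hu
        exact Real.smoothTransition.one_of_one_le hu.le
      rw [this.deriv_eq, deriv_const]
  exact hcont.bounded_above_of_compact_support hsupp

theorem exists_bound_deriv_bump : ∃ K : ℝ, 0 ≤ K ∧ ∀ a b y : ℝ, 0 ≤ a → a < b → b ≤ 1 / 4 →
    |deriv (bump a b) y| ≤ K / (b ^ 2 - a ^ 2) := by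
  obtain ⟨K, hK⟩ := exists_bound_deriv_smoothTransition
  have hK0 : 0 ≤ K := (abs_nonneg _).trans (hK 0)
  refine ⟨K * (2 * Real.pi), by positivity, fun a b y ha hab hb ↦ ?_⟩
  have hpi := Real.pi_pos
  have hge := cos_sub_cos_ge ha hab.le hb
  have hsq : 0 < b ^ 2 - a ^ 2 := by nlinarith
  set d := Real.cos (2 * Real.pi * a) - Real.cos (2 * Real.pi * b) with hd
  have h1 : HasDerivAt (fun y ↦ (Real.cos (2 * Real.pi * y) - Real.cos (2 * Real.pi * b)) / d)
      (-Real.sin (2 * Real.pi * y) * (2 * Real.pi) / d) y := by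
    have := ((hasDerivAt_id y).const_mul (2 * Real.pi)).cos
    simpa using (this.sub_const (Real.cos (2 * Real.pi * b))).div_const d
  have h2 := ((Real.smoothTransition.contDiff (n := 1)).differentiable one_ne_zero
    ((Real.cos (2 * Real.pi * y) - Real.cos (2 * Real.pi * b)) / d)).hasDerivAt.comp y h1
  rw [show bump a b = Real.smoothTransition ∘
    (fun y ↦ (Real.cos (2 * Real.pi * y) - Real.cos (2 * Real.pi * b)) / d) from rfl, h2.deriv,
    abs_mul, mul_div_assoc K]
  refine mul_le_mul (hK _) ?_ (abs_nonneg _) hK0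
  rw [abs_div, abs_mul, abs_neg, abs_of_pos Real.two_pi_pos, abs_of_pos (by linarith : 0 < d)]
  exact div_le_div₀ (by positivity)
    (mul_le_of_le_one_left (by positivity) (Real.abs_sin_le_one _)) hsq (by linarith)

theorem integral_bump_eq (a b : ℝ) :
    ∫ y in (0 : ℝ)..1, bump a b y = ∫ y in (-(1 / 2) : ℝ)..(1 / 2), bump a b y := by
  have := (bump_periodic a b).intervalIntegral_add_eq 0 (-(1 / 2))
  norm_num at this ⊢
  exact this

theorem le_integral_bump {a b : ℝ} (ha : 0 ≤ a) (hab : a < b) (hb : b ≤ 1 / 4) :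
    2 * a ≤ ∫ y in (0 : ℝ)..1, bump a b y := by
  have hint (u v : ℝ) : IntervalIntegrable (bump a b) volume u v :=
    (continuous_bump a b).intervalIntegrable u v
  have h1 : ∫ y in (-a)..a, bump a b y = ∫ _ in (-a)..a, (1 : ℝ) := by
    refine intervalIntegral.integral_congr fun y hy ↦ ?_
    rw [Set.uIcc_of_le (by linarith), Set.mem_Icc, ← abs_le] at hy
    exact bump_eq_one ha hab hb ((distInt_eq_abs (by linarith)).trans_le hy)
  rw [integral_bump_eq]
  calc 2 * a = ∫ y in (-a)..a, bump a b y := by rw [h1]; simp; ring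
    _ ≤ _ := intervalIntegral.integral_mono_interval (by linarith) (by linarith) (by linarith)
      (ae_of_all _ fun y ↦ bump_nonneg a b y) (hint _ _)

theorem integral_bump_le {a b : ℝ} (ha : 0 ≤ a) (hab : a < b) (hb : b ≤ 1 / 4) :
    ∫ y in (0 : ℝ)..1, bump a b y ≤ 2 * b := by
  have hint (u v : ℝ) : IntervalIntegrable (bump a b) volume u v :=
    (continuous_bump a b).intervalIntegrable u v
  have hzero {u v : ℝ} (huv : u ≤ v) (h : ∀ y ∈ Set.Icc u v, b ≤ |y| ∧ |y| ≤ 1 / 2) :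
      ∫ y in u..v, bump a b y = 0 := by
    rw [intervalIntegral.integral_congr (g := fun _ ↦ 0), intervalIntegral.integral_zero]
    intro y hy
    rw [Set.uIcc_of_le huv] at hy
    exact bump_eq_zero ha hab hb ((h y hy).1.trans_eq (distInt_eq_abs (h y hy).2).symm)
  have hmid : ∫ y in (-b)..b, bump a b y ≤ 2 * b := by
    calc _ ≤ ∫ _ in (-b)..b, (1 : ℝ) := intervalIntegral.integral_mono_on (by linarith)
          (hint _ _) (by simp) fun y _ ↦ bump_le_one a b y
      _ = 2 * b := by simp; ring
  rw [integral_bump_eq, ← intervalIntegral.integral_add_adjacent_intervals (hint _ (-b)) (hint _ _),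
    ← intervalIntegral.integral_add_adjacent_intervals (hint (-b) b) (hint _ _),
    hzero (u := -(1 / 2)) (v := -b) (by linarith), hzero (u := b) (v := 1 / 2) (by linarith)]
  · linarith
  · rintro y ⟨h1, h2⟩
    rw [abs_of_nonneg (by linarith)]
    exact ⟨h1, h2⟩
  · rintro y ⟨h1, h2⟩
    rw [abs_of_nonpos (by linarith)]
    constructor <;> linarith

/-- A periodic continuous function with mean zero has a bounded primitive. -/
theorem exists_bounded_primitive {ψ : ℝ → ℝ} (hc : Continuous ψ) (hp : Function.Periodic ψ 1)
    (h0 : ∫ y in (0 : ℝ)..1, ψ y = 0) (h1 : ∀ y, |ψ y| ≤ 1) :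
    ∃ Ψ : ℝ → ℝ, (∀ y, HasDerivAt Ψ (ψ y) y) ∧ ∀ y, |Ψ y| ≤ 1 := by
  refine ⟨fun y ↦ ∫ t in (0 : ℝ)..y, ψ t, fun y ↦
    intervalIntegral.integral_hasDerivAt_right (hc.intervalIntegrable _ _)
      hc.aestronglyMeasurable.stronglyMeasurableAtFilter hc.continuousAt, fun y ↦ ?_⟩
  have hper : Function.Periodic (fun y ↦ ∫ t in (0 : ℝ)..y, ψ t) 1 := fun y ↦ by
    have := hp.intervalIntegral_add_eq y 0
    rw [zero_add, h0] at this
    simp only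
    rw [← intervalIntegral.integral_add_adjacent_intervals (hc.intervalIntegrable 0 y)
      (hc.intervalIntegrable _ _), this, add_zero]
  have hfr : ∫ t in (0 : ℝ)..y, ψ t = ∫ t in (0 : ℝ)..Int.fract y, ψ t := by
    have := hper.sub_int_mul_eq (x := y) ⌊y⌋
    simp only [mul_one] at this
    exact this.symm
  simp only
  rw [hfr, ← Real.norm_eq_abs]
  refine (intervalIntegral.norm_integral_le_of_norm_le_const (C := 1) fun t _ ↦ h1 t).trans ?_
  rw [sub_zero, one_mul, abs_of_nonneg (Int.fract_nonneg y)]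
  exact (Int.fract_lt_one y).le

theorem hasDerivAt_pow_div {x : ℝ} (hx : x ≠ 0) (n : ℕ) :
    HasDerivAt (fun y : ℝ ↦ y ^ n) (n * x ^ n / x) x := by
  refine (hasDerivAt_pow n x).congr_deriv ?_
  rcases n with _ | n
  · simp
  · rw [Nat.add_sub_cancel, pow_succ]
    field_simp

/-- If `f₂ = x ^ n' - x ^ m'` oscillates much faster than `f₁ = x ^ n - x ^ m`, then a periodic
function of mean zero evaluated at `f₂` is nearly orthogonal to a smooth function of `f₁`. -/
theorem exists_abs_integral_comp_mul_comp_le {A B : ℝ} (hA : 1 < A) (hAB : A ≤ B) :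
    ∃ C : ℝ, 0 ≤ C ∧ ∀ (G ψ Ψ : ℝ → ℝ) (M : ℝ), ContDiff ℝ 1 G → (∀ y, |G y| ≤ 1) →
      (∀ y, |deriv G y| ≤ M) → Continuous ψ → (∀ y, HasDerivAt Ψ (ψ y) y) → (∀ y, |Ψ y| ≤ 1) →
      ∀ m n m' n' : ℕ, m < n → m' < n' → n ≤ n' →
        |∫ x in A..B, G (x ^ n - x ^ m) * ψ (x ^ n' - x ^ m')| ≤
          C * (1 + M) * A⁻¹ ^ (n' - n) := by
  set ρ := B / (A - 1) with hρ
  have hA0 : 0 < A - 1 := by linarith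
  have hρ0 : 0 < ρ := div_pos (by linarith) hA0
  refine ⟨2 * (B * ρ) + (B - A) * (ρ + ρ ^ 2), by
    have := sub_nonneg.2 hAB
    have : 0 < B := by linarith
    positivity, ?_⟩
  intro G ψ Ψ M hG hG1 hGM hψ hΨ hΨ1 m n m' n' hmn hmn' hnn'
  have hM0 : 0 ≤ M := (abs_nonneg _).trans (hGM 0)
  have hΨc : Continuous Ψ := continuous_iff_continuousAt.2 fun y ↦ (hΨ y).continuousAt
  have hG'c : Continuous (deriv G) := hG.continuous_deriv le_rfl
  set q := A⁻¹ ^ (n' - n) with hq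
  have hq0 : 0 < q := by positivity
  set h : ℝ → ℝ := fun x ↦ n' * x ^ n' - m' * x ^ m' with hh
  set h' : ℝ → ℝ := fun x ↦ n' * (n' * x ^ n' / x) - m' * (m' * x ^ m' / x) with hh'
  set R : ℝ → ℝ := fun x ↦
    deriv G (x ^ n - x ^ m) * ((n * x ^ n / x - m * x ^ m / x) * (x / h x)) * Ψ (x ^ n' - x ^ m')
      + G (x ^ n - x ^ m) * Ψ (x ^ n' - x ^ m') * ((1 * h x - x * h' x) / h x ^ 2) with hR
  set F : ℝ → ℝ := fun x ↦ G (x ^ n - x ^ m) * (Ψ (x ^ n' - x ^ m') * (x / h x)) with hF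
  have hn'0 : (1 : ℝ) ≤ n' := by exact_mod_cast (by omega : 1 ≤ n')
  have hmul {x : ℝ} (hx : x ∈ Set.Icc A B) : n' * x ^ n' ≤ ρ * h x := by
    have hx1 : 1 ≤ x := hA.le.trans hx.1
    have hp : (0 : ℝ) ≤ x ^ n' := by positivity
    have h1 : (m' : ℝ) * x ^ (m' + 1) ≤ n' * x ^ n' := by
      gcongr
      exact hmn'
    have h2 : n' * x ^ n' * (A - 1) ≤ h x * x := by
      have : n' * x ^ n' * (A - 1) ≤ n' * x ^ n' * (x - 1) := by gcongr; exact hx.1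
      rw [hh]
      simp only
      rw [pow_succ] at h1
      linarith
    have h3 : 0 ≤ h x := by
      by_contra hneg
      have : 0 ≤ n' * x ^ n' * (A - 1) := by positivity
      nlinarith
    rw [hρ, div_mul_eq_mul_div, le_div_iff₀ hA0]
    nlinarith [hx.2]
  have hhpos {x : ℝ} (hx : x ∈ Set.Icc A B) : 0 < h x := by
    have hx1 : 1 ≤ x := hA.le.trans hx.1
    have hp : 0 < n' * x ^ n' := by positivity
    exact pos_of_mul_pos_right (hp.trans_le (hmul hx)) hρ0.le
  have hratio {x : ℝ} (hx : x ∈ Set.Icc A B) : x ^ n ≤ q * x ^ n' := by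
    have hx0 : 0 < x := by linarith [hx.1]
    have : x⁻¹ ^ (n' - n) ≤ q := by
      rw [hq]
      gcongr
      exact hx.1
    calc x ^ n = x⁻¹ ^ (n' - n) * x ^ n' := by
          conv_rhs => rw [← Nat.sub_add_cancel hnn', pow_add, ← mul_assoc, Nat.sub_add_cancel hnn',
            ← mul_pow, inv_mul_cancel₀ hx0.ne', one_pow, one_mul]
      _ ≤ _ := by gcongr
  have hone {x : ℝ} (hx : x ∈ Set.Icc A B) : 1 ≤ q * x ^ n' :=
    (one_le_pow₀ (hA.le.trans hx.1)).trans (hratio hx)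
  have hD {x : ℝ} (hx : x ∈ Set.Icc A B) : |x / h x| ≤ B * ρ * q := by
    have hx0 : 0 < x := by linarith [hx.1]
    have hh0 := hhpos hx
    rw [abs_of_nonneg (by positivity), div_le_iff₀ hh0]
    have h1 : 1 ≤ ρ * q * h x := by
      calc 1 ≤ q * (1 * x ^ n') := by rw [one_mul]; exact hone hx
        _ ≤ q * (n' * x ^ n') := by gcongr
        _ ≤ q * (ρ * h x) := mul_le_mul_of_nonneg_left (hmul hx) hq0.le
        _ = _ := by ring
    nlinarith [hx.2]
  have hD1 {x : ℝ} (hx : x ∈ Set.Icc A B) :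
      |(n * x ^ n / x - m * x ^ m / x) * (x / h x)| ≤ ρ * q := by
    have hx0 : 0 < x := by linarith [hx.1]
    have hx1 : 1 ≤ x := hA.le.trans hx.1
    have hh0 := hhpos hx
    have h1 : (m : ℝ) * x ^ m ≤ n * x ^ n := by gcongr
    have h2 : (n : ℝ) * x ^ n - m * x ^ m ≤ ρ * q * h x := by
      calc (n : ℝ) * x ^ n - m * x ^ m ≤ n * x ^ n := by
            have : 0 ≤ (m : ℝ) * x ^ m := by positivity
            linarith
        _ ≤ n' * (q * x ^ n') := by gcongr; exact hratio hx
        _ = q * (n' * x ^ n') := by ring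
        _ ≤ q * (ρ * h x) := mul_le_mul_of_nonneg_left (hmul hx) hq0.le
        _ = _ := by ring
    rw [← sub_div, div_mul_div_cancel₀ hx0.ne', abs_of_nonneg (div_nonneg (by linarith) hh0.le),
      div_le_iff₀ hh0]
    exact h2
  have hD2 {x : ℝ} (hx : x ∈ Set.Icc A B) : |(1 * h x - x * h' x) / h x ^ 2| ≤ ρ ^ 2 * q := by
    have hx0 : 0 < x := by linarith [hx.1]
    have hx1 : 1 ≤ x := hA.le.trans hx.1
    have hh0 := hhpos hx
    have e : x * h' x = n' * (n' * x ^ n') - m' * (m' * x ^ m') := by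
      simp only [hh']
      field_simp
    have hpow_le : (m' : ℝ) * (m' * x ^ m') ≤ m' * (n' * x ^ n') := by gcongr
    have hm1 : (m' : ℝ) + 1 ≤ n' := by exact_mod_cast hmn'
    have hle : |1 * h x - x * h' x| ≤ n' * (n' * x ^ n') := by
      have hp : (0 : ℝ) ≤ x ^ m' := by positivity
      have hp' : 0 ≤ (n' : ℝ) * x ^ n' := by positivity
      have hq' : 0 ≤ (m' : ℝ) * (m' * x ^ m') := by positivity
      have hq'' : 0 ≤ (m' : ℝ) * x ^ m' := by positivity
      have hmm : (m' : ℝ) * x ^ m' ≤ m' * (m' * x ^ m') := by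
        rcases Nat.eq_zero_or_pos m' with h0 | h0
        · simp [h0]
        · exact le_mul_of_one_le_left hq'' (by exact_mod_cast h0)
      rw [e, abs_le]
      simp only [hh]
      constructor <;> nlinarith
    rw [abs_div, abs_of_pos (by positivity : 0 < h x ^ 2), div_le_iff₀ (by positivity)]
    calc |1 * h x - x * h' x| ≤ n' * (n' * x ^ n') * 1 := by rw [mul_one]; exact hle
      _ ≤ n' * (n' * x ^ n') * (q * x ^ n') := by gcongr; exact hone hx
      _ = q * (n' * x ^ n') ^ 2 := by ring
      _ ≤ q * (ρ * h x) ^ 2 :=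
        mul_le_mul_of_nonneg_left (pow_le_pow_left₀ (by positivity) (hmul hx) 2) hq0.le
      _ = _ := by ring
  have hderiv : ∀ x ∈ Set.uIcc A B,
      HasDerivAt F (G (x ^ n - x ^ m) * ψ (x ^ n' - x ^ m') + R x) x := by
    intro x hx
    rw [Set.uIcc_of_le hAB] at hx
    have hx0 : x ≠ 0 := by linarith [hx.1]
    have hh0 := (hhpos hx).ne'
    have d1 := ((hG.differentiable one_ne_zero (x ^ n - x ^ m)).hasDerivAt).comp x
      ((hasDerivAt_pow_div hx0 n).sub (hasDerivAt_pow_div hx0 m))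
    have d2 := (hΨ (x ^ n' - x ^ m')).comp x
      ((hasDerivAt_pow_div hx0 n').sub (hasDerivAt_pow_div hx0 m'))
    have dh : HasDerivAt h (h' x) x :=
      ((hasDerivAt_pow_div hx0 n').const_mul (n' : ℝ)).sub
        ((hasDerivAt_pow_div hx0 m').const_mul (m' : ℝ))
    have d3 := (hasDerivAt_id x).div dh hh0
    refine (d1.mul (d2.mul d3)).congr_deriv ?_
    have e : (n' * x ^ n' / x - m' * x ^ m' / x) * (x / h x) = 1 := by
      rw [← sub_div, div_mul_div_cancel₀ hx0]
      exact div_self hh0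
    simp only [hR, Function.comp_apply, id_eq, Pi.sub_apply, Pi.div_apply, Pi.mul_apply]
    linear_combination (G (x ^ n - x ^ m) * ψ (x ^ n' - x ^ m')) * e
  have hcG : Continuous fun x : ℝ ↦ G (x ^ n - x ^ m) * ψ (x ^ n' - x ^ m') := by
    have := hG.continuous
    fun_prop
  have hRc : ContinuousOn R (Set.uIcc A B) := by
    rw [Set.uIcc_of_le hAB]
    have hne : ∀ x ∈ Set.Icc A B, x ≠ 0 := fun x hx ↦ by linarith [hx.1]
    have hne' : ∀ x ∈ Set.Icc A B, h x ≠ 0 := fun x hx ↦ (hhpos hx).ne'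
    have hne2 : ∀ x ∈ Set.Icc A B, h x ^ 2 ≠ 0 := fun x hx ↦ pow_ne_zero 2 (hne' x hx)
    have hch : ContinuousOn h (Set.Icc A B) := by fun_prop
    have hch' : ContinuousOn h' (Set.Icc A B) := by fun_prop (disch := assumption)
    have := hG.continuous
    fun_prop (disch := assumption)
  have hRb : |∫ x in A..B, R x| ≤ (M * (ρ * q) + ρ ^ 2 * q) * (B - A) := by
    rw [← abs_of_nonneg (sub_nonneg.2 hAB), ← Real.norm_eq_abs]
    refine intervalIntegral.norm_integral_le_of_norm_le_const fun x hx ↦ ?_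
    rw [Set.uIoc_of_le hAB] at hx
    have hx' : x ∈ Set.Icc A B := ⟨hx.1.le, hx.2⟩
    refine (norm_add_le _ _).trans (add_le_add ?_ ?_)
    · rw [Real.norm_eq_abs, abs_mul, abs_mul, ← mul_one (M * (ρ * q))]
      gcongr
      · exact hGM _
      · exact hD1 hx'
      · exact hΨ1 _
    · rw [Real.norm_eq_abs, abs_mul, abs_mul]
      refine (mul_le_mul (mul_le_one₀ (hG1 _) (abs_nonneg _) (hΨ1 _)) (hD2 hx') (abs_nonneg _)
        zero_le_one).trans_eq (one_mul _)
  have hFb {x : ℝ} (hx : x ∈ Set.Icc A B) : |F x| ≤ B * ρ * q := by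
    rw [hF]
    simp only
    rw [abs_mul, abs_mul, ← one_mul (B * ρ * q), ← one_mul (1 * _)]
    rw [← mul_assoc, ← mul_assoc (1 : ℝ) 1]
    refine mul_le_mul (mul_le_mul (hG1 _) (hΨ1 _) (abs_nonneg _) zero_le_one) ?_ (abs_nonneg _)
      (by norm_num)
    simpa using hD hx
  have key := intervalIntegral.integral_eq_sub_of_hasDerivAt hderiv
    ((hcG.intervalIntegrable _ _).add hRc.intervalIntegrable)
  rw [intervalIntegral.integral_add (hcG.intervalIntegrable _ _) hRc.intervalIntegrable] at key
  have hFA := hFb (Set.left_mem_Icc.2 hAB)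
  have hFB := hFb (Set.right_mem_Icc.2 hAB)
  rw [abs_le] at hFA hFB hRb
  have hfin : |∫ x in A..B, G (x ^ n - x ^ m) * ψ (x ^ n' - x ^ m')| ≤
      2 * (B * ρ * q) + (M * (ρ * q) + ρ ^ 2 * q) * (B - A) := by
    rw [abs_le]
    constructor <;> linarith
  refine hfin.trans ?_
  have hBA := sub_nonneg.2 hAB
  have hB0 : 0 < B := by linarith
  have p1 : 0 ≤ 2 * (B * ρ) * M * q := by positivity
  have p2 : 0 ≤ (B - A) * ρ * q := by positivity
  have p3 : 0 ≤ (B - A) * ρ ^ 2 * M * q := by positivity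
  linarith

theorem exists_pow_mul_inv_pow_le {A : ℝ} (hA : 1 < A) (p : ℕ) :
    ∃ C : ℝ, 0 ≤ C ∧ ∀ k : ℕ, (k : ℝ) ^ p * A⁻¹ ^ k ≤ C := by
  have h0 : 0 < A := by linarith
  have h := tendsto_pow_const_mul_const_pow_of_lt_one p (inv_nonneg.2 h0.le) (inv_lt_one_of_one_lt₀ hA)
  obtain ⟨C, hC⟩ := h.bddAbove_range
  have hC' (k : ℕ) : (k : ℝ) ^ p * A⁻¹ ^ k ≤ C := hC ⟨k, rfl⟩
  exact ⟨C, le_trans (by positivity) (hC' 0), hC'⟩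

theorem abs_sub_le_one_of_mem {u v : ℝ} (hu0 : 0 ≤ u) (hu1 : u ≤ 1) (hv0 : 0 ≤ v) (hv1 : v ≤ 1) :
    |u - v| ≤ 1 := by
  rw [abs_le]
  constructor <;> linarith

theorem integral_bump_nonneg (a b : ℝ) : 0 ≤ ∫ y in (0 : ℝ)..1, bump a b y :=
  intervalIntegral.integral_nonneg zero_le_one fun y _ ↦ bump_nonneg a b y

theorem integral_bump_le_one (a b : ℝ) : ∫ y in (0 : ℝ)..1, bump a b y ≤ 1 := by
  calc _ ≤ ∫ _ in (0 : ℝ)..1, (1 : ℝ) := intervalIntegral.integral_mono_on zero_le_one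
        ((continuous_bump a b).intervalIntegrable _ _) (by simp) fun y _ ↦ bump_le_one a b y
    _ = 1 := by simp

theorem exists_bounded_primitive_bump (a b : ℝ) : ∃ Ψ : ℝ → ℝ,
    (∀ y, HasDerivAt Ψ (bump a b y - ∫ t in (0 : ℝ)..1, bump a b t) y) ∧ ∀ y, |Ψ y| ≤ 1 := by
  refine exists_bounded_primitive ((continuous_bump a b).sub continuous_const)
    (fun y ↦ by simp only [bump_periodic a b y]) ?_ fun y ↦ abs_sub_le_one_of_mem
      (bump_nonneg _ _ _) (bump_le_one _ _ _) (integral_bump_nonneg _ _) (integral_bump_le_one _ _)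
  rw [intervalIntegral.integral_sub ((continuous_bump a b).intervalIntegrable _ _) (by simp)]
  simp

/-- Decorrelation of `x ^ n' - x ^ m'` from `x ^ n - x ^ m` when `n'` exceeds `n` by at
least `k`, for test functions varying polynomially fast in `k`. -/
theorem exists_abs_integral_comp_mul_bump_sub_le {A B : ℝ} (hA : 1 < A) (hAB : A ≤ B) (K : ℝ)
    (hK : 0 ≤ K) : ∃ C : ℝ, 0 ≤ C ∧ ∀ k : ℕ, 1 ≤ k → ∀ (G : ℝ → ℝ) (a b : ℝ), ContDiff ℝ 1 G →
      (∀ y, |G y| ≤ 1) → (∀ y, |deriv G y| ≤ K * k ^ 10) →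
      ∀ m n m' n' : ℕ, m < n → m' < n' → n + k ≤ n' →
        |∫ x in A..B, G (x ^ n - x ^ m) *
          (bump a b (x ^ n' - x ^ m') - ∫ t in (0 : ℝ)..1, bump a b t)| ≤ C / k ^ 12 := by
  obtain ⟨C, hC0, hC⟩ := exists_abs_integral_comp_mul_comp_le hA hAB
  obtain ⟨D, hD0, hD⟩ := exists_pow_mul_inv_pow_le hA 22
  refine ⟨C * (1 + K) * D, by positivity, fun k hk G a b hG hG1 hG' m n m' n' hmn hmn' hnn' ↦ ?_⟩
  obtain ⟨Ψ, hΨ, hΨ1⟩ := exists_bounded_primitive_bump a b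
  refine (hC G _ Ψ _ hG hG1 hG' ((continuous_bump a b).sub continuous_const) hΨ hΨ1 m n m' n'
    hmn hmn' (by omega)).trans ?_
  have hk1 : (1 : ℝ) ≤ k := by exact_mod_cast hk
  have hk10 : (1 : ℝ) ≤ (k : ℝ) ^ 10 := one_le_pow₀ hk1
  have hq : A⁻¹ ^ (n' - n) ≤ A⁻¹ ^ k :=
    pow_le_pow_of_le_one (by have : 0 < A := by linarith
                             positivity) (inv_le_one_of_one_le₀ hA.le) (by omega)
  have hA0 : 0 < A⁻¹ := inv_pos.2 (by linarith)
  rw [le_div_iff₀ (by positivity)]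
  calc C * (1 + K * k ^ 10) * A⁻¹ ^ (n' - n) * k ^ 12
      ≤ C * (k ^ 10 + K * k ^ 10) * A⁻¹ ^ k * k ^ 12 := by gcongr
    _ = C * (1 + K) * (k ^ 22 * A⁻¹ ^ k) := by ring
    _ ≤ C * (1 + K) * D := by gcongr; exact hD k

theorem sum_boole_le {s : Finset ℕ} (p : ℕ → Prop) [DecidablePred p] {t : Finset ℕ} {k : ℕ}
    (h : ∀ m ∈ s, p m → m ∈ t) (ht : t.card ≤ k) :
    ∑ m ∈ s, (if p m then (1 : ℝ) else 0) ≤ k := by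
  rw [Finset.sum_boole]
  exact_mod_cast (Finset.card_le_card fun m hm ↦ h m (Finset.mem_filter.1 hm).1
    (Finset.mem_filter.1 hm).2).trans ht

theorem integral_sum_sq_le {A B c : ℝ} (hAB : A ≤ B) (hc : 0 ≤ c) {k n : ℕ} {N : ℝ} (hk : 1 ≤ k)
    (hnN : n ≤ N) (hN : 0 < N) {a : ℕ → ℝ → ℝ} (ha : ∀ m, Continuous (a m))
    (ha0 : ∀ m x, 0 ≤ a m x) (ha1 : ∀ m x, a m x ≤ 1)
    (hone : ∀ m < n, ∫ x in A..B, a m x ≤ c / N)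
    (htwo : ∀ m m', m < m' → k < m' → m' + k ≤ n → ∫ x in A..B, a m x * a m' x ≤ c / N ^ 2) :
    ∫ x in A..B, (∑ m ∈ Finset.Ico 1 n, a m x) ^ 2 ≤ 5 * c * k := by
  have hk' : (1 : ℝ) ≤ k := by exact_mod_cast hk
  let w (m m' : ℕ) : ℝ := c / N ^ 2 + c / N * ((if m' = m then 1 else 0) +
    (if m ≤ k then 1 else 0) + (if n < m + k then 1 else 0) + (if n < m' + k then 1 else 0))
  have hw : ∀ m ∈ Finset.Ico 1 n, ∀ m' ∈ Finset.Ico 1 n, ∫ x in A..B, a m x * a m' x ≤ w m m' := by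
    intro m hm m' hm'
    rw [Finset.mem_Ico] at hm hm'
    by_cases hgood : m' ≠ m ∧ k < m ∧ m + k ≤ n ∧ m' + k ≤ n
    · obtain ⟨h1, h2, h3, h4⟩ := hgood
      have hle : ∫ x in A..B, a m x * a m' x ≤ c / N ^ 2 := by
        rcases lt_or_gt_of_ne h1 with h | h
        · simp only [mul_comm (a m _)]
          exact htwo m' m h h2 h3
        · exact htwo m m' h (by omega) h4
      refine hle.trans (le_add_of_nonneg_right (mul_nonneg (by positivity) ?_))
      split_ifs <;> norm_num
    · have hle : ∫ x in A..B, a m x * a m' x ≤ c / N := by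
        refine le_trans (intervalIntegral.integral_mono_on hAB
          (((ha m).mul (ha m')).intervalIntegrable _ _) ((ha m).intervalIntegrable _ _)
          fun x _ ↦ mul_le_of_le_one_right (ha0 m x) (ha1 m' x)) (hone m hm.2)
      have h1 : (1 : ℝ) ≤ (if m' = m then 1 else 0) + (if m ≤ k then 1 else 0) +
          (if n < m + k then 1 else 0) + (if n < m' + k then 1 else 0) := by
        split_ifs <;> norm_num
        omega
      have h2 : c / N * 1 ≤ c / N * _ := mul_le_mul_of_nonneg_left h1 (by positivity)
      have h3 : 0 ≤ c / N ^ 2 := by positivity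
      simp only [w]
      linarith
  have hcard : ((Finset.Ico 1 n).card : ℝ) ≤ N := by
    rw [Nat.card_Ico]
    exact le_trans (by exact_mod_cast Nat.sub_le n 1) hnN
  have hupper : ∑ m ∈ Finset.Ico 1 n, (if n < m + k then (1 : ℝ) else 0) ≤ k :=
    sum_boole_le _ (t := Finset.Ico (n - k) n)
      (fun m hm h ↦ by rw [Finset.mem_Ico] at hm ⊢; omega) (by rw [Nat.card_Ico]; omega)
  have hlower : ∑ m ∈ Finset.Ico 1 n, (if m ≤ k then (1 : ℝ) else 0) ≤ k :=
    sum_boole_le _ (t := Finset.Icc 1 k)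
      (fun m hm h ↦ by rw [Finset.mem_Ico] at hm; rw [Finset.mem_Icc]; omega) (by simp)
  have hdiag (m : ℕ) : ∑ m' ∈ Finset.Ico 1 n, (if m' = m then (1 : ℝ) else 0) ≤ 1 :=
    (sum_boole_le (k := 1) _ (t := {m}) (by simp) (by simp)).trans (by simp)
  calc ∫ x in A..B, (∑ m ∈ Finset.Ico 1 n, a m x) ^ 2
      = ∑ m ∈ Finset.Ico 1 n, ∑ m' ∈ Finset.Ico 1 n, ∫ x in A..B, a m x * a m' x := by
        simp_rw [sq, Finset.sum_mul_sum]
        rw [intervalIntegral.integral_finsetSum]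
        · refine Finset.sum_congr rfl fun m _ ↦ intervalIntegral.integral_finsetSum
            fun m' _ ↦ ((ha m).mul (ha m')).intervalIntegrable _ _
        · exact fun m _ ↦ (continuous_finsetSum _ fun m' _ ↦
            (ha m).mul (ha m')).intervalIntegrable _ _
    _ ≤ ∑ m ∈ Finset.Ico 1 n, ∑ m' ∈ Finset.Ico 1 n, w m m' :=
        Finset.sum_le_sum fun m hm ↦ Finset.sum_le_sum fun m' hm' ↦ hw m hm m' hm'
    _ ≤ ∑ m ∈ Finset.Ico 1 n, (c / N + c / N * (1 + k) +
          c * ((if m ≤ k then 1 else 0) + (if n < m + k then 1 else 0))) := by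
        refine Finset.sum_le_sum fun m _ ↦ ?_
        simp only [w, Finset.sum_add_distrib, ← Finset.mul_sum, Finset.sum_const, nsmul_eq_mul]
        set u : ℝ := if m ≤ k then 1 else 0
        set v : ℝ := if n < m + k then 1 else 0
        have hu : 0 ≤ u := by simp only [u]; split_ifs <;> norm_num
        have hv : 0 ≤ v := by simp only [v]; split_ifs <;> norm_num
        have e1 : ((Finset.Ico 1 n).card : ℝ) * (c / N ^ 2) ≤ c / N := by
          calc _ ≤ N * (c / N ^ 2) := by gcongr
            _ = c / N := by field_simp
        have e2 : c / N * (∑ m' ∈ Finset.Ico 1 n, (if m' = m then (1 : ℝ) else 0) +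
            (Finset.Ico 1 n).card * u + (Finset.Ico 1 n).card * v +
            ∑ m' ∈ Finset.Ico 1 n, (if n < m' + k then (1 : ℝ) else 0)) ≤
            c / N * (1 + N * u + N * v + k) := by
          gcongr
          exact hdiag m
        have e3 : c / N * (1 + N * u + N * v + k) = c / N * (1 + k) + c * (u + v) := by
          field_simp
          ring
        linarith
    _ ≤ c * (1 + (1 + k) + (k + k)) := by
        simp only [Finset.sum_add_distrib, ← Finset.mul_sum, Finset.sum_const, nsmul_eq_mul]
        have e1 : ((Finset.Ico 1 n).card : ℝ) * (c / N + c / N * (1 + k)) ≤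
            N * (c / N + c / N * (1 + k)) := by gcongr
        have e2 : N * (c / N + c / N * (1 + k)) = c * (1 + (1 + k)) := by
          field_simp
        have e3 := mul_le_mul_of_nonneg_left (add_le_add hlower hupper) hc
        linarith
    _ ≤ 5 * c * k := by nlinarith

theorem integral_sum_sub_sq_le {A B c : ℝ} (hAB : A ≤ B) (hc : 0 ≤ c) {k n : ℕ} {N μ : ℝ}
    (hk : 1 ≤ k) (hnN : n ≤ N) (hN : 0 < N) (hμ0 : 0 ≤ μ) (hμ1 : μ ≤ 1) (hμ : μ ≤ c / N)
    {a : ℕ → ℝ → ℝ} (ha : ∀ m, Continuous (a m))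
    (ha0 : ∀ m x, 0 ≤ a m x) (ha1 : ∀ m x, a m x ≤ 1)
    (hone : k < n → ∀ m < n, ∫ x in A..B, a m x ≤ c / N)
    (htwo : ∀ m m', m < m' → k < m' → m' + k ≤ n → ∫ x in A..B, a m x * a m' x ≤ c / N ^ 2) :
    ∫ x in A..B, (∑ m ∈ Finset.Ico 1 n, (a m x - μ)) ^ 2 ≤
      ((B - A) + 10 * c + 2 * c ^ 2 * (B - A)) * k ^ 2 := by
  have hk' : (1 : ℝ) ≤ k := by exact_mod_cast hk
  have hBA := sub_nonneg.2 hAB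
  have hcY : Continuous fun x ↦ (∑ m ∈ Finset.Ico 1 n, (a m x - μ)) ^ 2 := by fun_prop
  have hcT : Continuous fun x ↦ (∑ m ∈ Finset.Ico 1 n, a m x) ^ 2 := by fun_prop
  rcases le_or_gt n k with hnk | hnk
  · have hpt (x : ℝ) : (∑ m ∈ Finset.Ico 1 n, (a m x - μ)) ^ 2 ≤ (k : ℝ) ^ 2 := by
      rw [sq_le_sq, abs_of_nonneg (by positivity : (0 : ℝ) ≤ k)]
      refine (Finset.abs_sum_le_sum_abs _ _).trans ((Finset.sum_le_card_nsmul _ _ 1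
        fun m _ ↦ abs_sub_le_one_of_mem (ha0 m x) (ha1 m x) hμ0 hμ1).trans ?_)
      rw [Nat.card_Ico, nsmul_eq_mul, mul_one]
      exact_mod_cast (by omega : n - 1 ≤ k)
    calc _ ≤ ∫ _ in A..B, (k : ℝ) ^ 2 := intervalIntegral.integral_mono_on hAB
          (hcY.intervalIntegrable _ _) (by simp) fun x _ ↦ hpt x
      _ = (B - A) * k ^ 2 := by simp
      _ ≤ _ := by
        gcongr
        have : 0 ≤ 10 * c + 2 * c ^ 2 * (B - A) := by positivity
        linarith
  · have hpt (x : ℝ) : (∑ m ∈ Finset.Ico 1 n, (a m x - μ)) ^ 2 ≤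
        2 * (∑ m ∈ Finset.Ico 1 n, a m x) ^ 2 + 2 * c ^ 2 := by
      rw [Finset.sum_sub_distrib, Finset.sum_const, nsmul_eq_mul]
      have h1 : ((Finset.Ico 1 n).card : ℝ) * μ ≤ c := by
        have hcard : ((Finset.Ico 1 n).card : ℝ) ≤ N := by
          rw [Nat.card_Ico]
          exact le_trans (by exact_mod_cast Nat.sub_le n 1) hnN
        calc _ ≤ N * (c / N) := by gcongr
          _ = c := by field_simp
      have h0 : 0 ≤ ((Finset.Ico 1 n).card : ℝ) * μ := by positivity
      have h2 := pow_le_pow_left₀ h0 h1 2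
      nlinarith [sq_nonneg (∑ m ∈ Finset.Ico 1 n, a m x + (Finset.Ico 1 n).card * μ)]
    have hT := integral_sum_sq_le hAB hc hk hnN hN ha ha0 ha1 (hone hnk) htwo
    calc _ ≤ ∫ x in A..B, (2 * (∑ m ∈ Finset.Ico 1 n, a m x) ^ 2 + 2 * c ^ 2) :=
          intervalIntegral.integral_mono_on hAB (hcY.intervalIntegrable _ _)
            (((hcT.const_mul 2).add continuous_const).intervalIntegrable _ _) fun x _ ↦ hpt x
      _ = 2 * (∫ x in A..B, (∑ m ∈ Finset.Ico 1 n, a m x) ^ 2) + 2 * c ^ 2 * (B - A) := by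
          rw [intervalIntegral.integral_add ((hcT.const_mul 2).intervalIntegrable _ _) (by simp)]
          simp
          ring
      _ ≤ 2 * (5 * c * k) + 2 * c ^ 2 * (B - A) := by gcongr
      _ ≤ 2 * (5 * c * k ^ 2) + 2 * c ^ 2 * (B - A) * k ^ 2 := by
          have h1 : (k : ℝ) ≤ k ^ 2 := by nlinarith
          have h2 : (1 : ℝ) ≤ k ^ 2 := by nlinarith
          have h3 : 0 ≤ 2 * c ^ 2 * (B - A) := by positivity
          have h4 := mul_le_mul_of_nonneg_left h1 hc
          have h5 := mul_le_mul_of_nonneg_left h2 h3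
          linarith
      _ ≤ _ := by
          have : 0 ≤ (B - A) * k ^ 2 := by positivity
          linarith

theorem integral_sum_sq_le_of_far {A B V E : ℝ} (hAB : A ≤ B) (hV : 0 ≤ V) (hE : 0 ≤ E)
    {k N : ℕ} {Y : ℕ → ℝ → ℝ} (hY : ∀ n, Continuous (Y n))
    (hvar : ∀ n ≤ N, ∫ x in A..B, Y n x ^ 2 ≤ V)
    (hfar : ∀ n n', n + k ≤ n' → n' ≤ N → |∫ x in A..B, Y n x * Y n' x| ≤ E) :
    ∫ x in A..B, (∑ n ∈ Finset.Icc 1 N, Y n x) ^ 2 ≤ N * (2 * k * V) + N ^ 2 * E := by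
  have hpair : ∀ n ∈ Finset.Icc 1 N, ∀ n' ∈ Finset.Icc 1 N, ∫ x in A..B, Y n x * Y n' x ≤
      (if n < n' + k ∧ n' < n + k then 1 else 0) * V + E := by
    intro n hn n' hn'
    rw [Finset.mem_Icc] at hn hn'
    have hint (j : ℕ) : IntervalIntegrable (fun x ↦ Y j x ^ 2 / 2) volume A B :=
      (((hY j).pow 2).div_const 2).intervalIntegrable _ _
    split_ifs with h
    · have : ∫ x in A..B, Y n x * Y n' x ≤ ∫ x in A..B, (Y n x ^ 2 / 2 + Y n' x ^ 2 / 2) := by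
        refine intervalIntegral.integral_mono_on hAB (((hY n).mul (hY n')).intervalIntegrable _ _)
          ((hint n).add (hint n')) fun x _ ↦ ?_
        nlinarith [sq_nonneg (Y n x - Y n' x)]
      rw [intervalIntegral.integral_add (hint n) (hint n'), intervalIntegral.integral_div,
        intervalIntegral.integral_div] at this
      linarith [hvar n hn.2, hvar n' hn'.2]
    · rw [zero_mul, zero_add]
      refine (le_abs_self _).trans ?_
      rcases not_and_or.1 h with h | h
      · simp only [mul_comm (Y n _)]
        exact hfar n' n (not_lt.1 h) hn.2
      · exact hfar n n' (not_lt.1 h) hn'.2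
  calc ∫ x in A..B, (∑ n ∈ Finset.Icc 1 N, Y n x) ^ 2
      = ∑ n ∈ Finset.Icc 1 N, ∑ n' ∈ Finset.Icc 1 N, ∫ x in A..B, Y n x * Y n' x := by
        simp_rw [sq, Finset.sum_mul_sum]
        rw [intervalIntegral.integral_finsetSum]
        · refine Finset.sum_congr rfl fun m _ ↦ intervalIntegral.integral_finsetSum
            fun m' _ ↦ ((hY m).mul (hY m')).intervalIntegrable _ _
        · exact fun m _ ↦ (continuous_finsetSum _ fun m' _ ↦
            (hY m).mul (hY m')).intervalIntegrable _ _
    _ ≤ ∑ n ∈ Finset.Icc 1 N, ∑ n' ∈ Finset.Icc 1 N,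
          ((if n < n' + k ∧ n' < n + k then 1 else 0) * V + E) :=
        Finset.sum_le_sum fun m hm ↦ Finset.sum_le_sum fun m' hm' ↦ hpair m hm m' hm'
    _ ≤ ∑ n ∈ Finset.Icc 1 N, (2 * k * V + N * E) := by
        refine Finset.sum_le_sum fun n _ ↦ ?_
        rw [Finset.sum_add_distrib, ← Finset.sum_mul, Finset.sum_const, Nat.card_Icc,
          nsmul_eq_mul, Nat.add_sub_cancel]
        gcongr
        refine (sum_boole_le (k := 2 * k) _ (t := Finset.Ico (n - k) (n + k))
          (fun m _ h ↦ by rw [Finset.mem_Ico]; omega) (by rw [Nat.card_Ico]; omega)).trans_eq ?_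
        push_cast
        ring
    _ = _ := by
        rw [Finset.sum_const, Nat.card_Icc, nsmul_eq_mul, Nat.add_sub_cancel]
        ring

/-- A second moment bound for the centred number of pairs, from pairwise decorrelation. -/
theorem integral_sum_sum_sub_sq_le {A B c C₀ : ℝ} (hAB : A ≤ B) (hc : 0 ≤ c) (hC₀ : 0 ≤ C₀)
    {k : ℕ} {μ : ℝ} (hk : 1 ≤ k) (hμ0 : 0 ≤ μ) (hμ1 : μ ≤ 1) (hμ : μ ≤ c / k ^ 5)
    {a : ℕ → ℕ → ℝ → ℝ} (ha : ∀ m n, Continuous (a m n))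
    (ha0 : ∀ m n x, 0 ≤ a m n x) (ha1 : ∀ m n x, a m n x ≤ 1)
    (hone : ∀ m n, k < n → m < n → ∫ x in A..B, a m n x ≤ c / k ^ 5)
    (htwo : ∀ m m' n, m < m' → k < m' → m' + k ≤ n →
      ∫ x in A..B, a m n x * a m' n x ≤ c / (k ^ 5) ^ 2)
    (hfar : ∀ m n m' n', m < n → m' < n' → n + k ≤ n' →
      |∫ x in A..B, (a m n x - μ) * (a m' n' x - μ)| ≤ C₀ / k ^ 12) :
    ∫ x in A..B, (∑ n ∈ Finset.Icc 1 (k ^ 5), ∑ m ∈ Finset.Ico 1 n, (a m n x - μ)) ^ 2 ≤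
      (2 * ((B - A) + 10 * c + 2 * c ^ 2 * (B - A)) + C₀) * k ^ 8 := by
  have hk' : (0 : ℝ) < k := by exact_mod_cast hk
  have hBA := sub_nonneg.2 hAB
  refine (integral_sum_sq_le_of_far (k := k) hAB
    (Y := fun n x ↦ ∑ m ∈ Finset.Ico 1 n, (a m n x - μ))
    (V := ((B - A) + 10 * c + 2 * c ^ 2 * (B - A)) * k ^ 2)
    (E := (k ^ 5) ^ 2 * (C₀ / k ^ 12)) (by positivity) (by positivity)
    (fun n ↦ continuous_finsetSum _ fun m _ ↦ (ha m n).sub continuous_const) ?_ ?_).trans_eq ?_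
  · intro n hn
    exact integral_sum_sub_sq_le (N := (k : ℝ) ^ 5) hAB hc hk (by exact_mod_cast hn)
      (by positivity) hμ0 hμ1 hμ (fun m ↦ ha m n) (fun m ↦ ha0 m n) (fun m ↦ ha1 m n)
      (fun h m hm ↦ hone m n h hm) fun m m' ↦ htwo m m' n
  · intro n n' hnn' hn'
    have hint (m m' : ℕ) :
        IntervalIntegrable (fun x ↦ (a m n x - μ) * (a m' n' x - μ)) volume A B :=
      (((ha m n).sub continuous_const).mul
        ((ha m' n').sub continuous_const)).intervalIntegrable _ _
    simp only [Finset.sum_mul_sum]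
    rw [intervalIntegral.integral_finsetSum]
    · have hcard {j : ℕ} (hj : j ≤ k ^ 5) : ((Finset.Ico 1 j).card : ℝ) ≤ (k : ℝ) ^ 5 := by
        rw [Nat.card_Ico]
        exact_mod_cast (Nat.sub_le j 1).trans hj
      refine (Finset.abs_sum_le_sum_abs _ _).trans ((Finset.sum_le_card_nsmul _ _
        ((k : ℝ) ^ 5 * (C₀ / k ^ 12)) fun m hm ↦ ?_).trans ?_)
      · rw [intervalIntegral.integral_finsetSum fun m' _ ↦ hint m m']
        refine (Finset.abs_sum_le_sum_abs _ _).trans ((Finset.sum_le_card_nsmul _ _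
          (C₀ / k ^ 12) fun m' hm' ↦ ?_).trans ?_)
        · exact hfar m n m' n' (Finset.mem_Ico.1 hm).2 (Finset.mem_Ico.1 hm').2 hnn'
        · rw [nsmul_eq_mul]
          gcongr
          exact hcard hn'
      · rw [nsmul_eq_mul, sq, mul_assoc]
        gcongr
        exact hcard (by omega)
    · intro m _
      exact (continuous_finsetSum _ fun m' _ ↦ ((ha m n).sub continuous_const).mul
        ((ha m' n').sub continuous_const)).intervalIntegrable _ _
  · push_cast
    field_simp

theorem bump_mul_bump_le {a b u v : ℝ} (ha : 0 ≤ a) (hab : a < b) (hb : 3 * b ≤ 1 / 4) :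
    bump a b u * bump a b v ≤ bump (2 * b) (3 * b) (u - v) * bump a b u := by
  have hb0 : 0 < b := ha.trans_lt hab
  have hR : 0 ≤ bump (2 * b) (3 * b) (u - v) * bump a b u :=
    mul_nonneg (bump_nonneg _ _ _) (bump_nonneg _ _ _)
  rcases le_total b (distInt u) with hu | hu
  · simp [bump_eq_zero ha hab (by linarith) hu]
  rcases le_total b (distInt v) with hv | hv
  · simpa [bump_eq_zero ha hab (by linarith) hv] using hR
  rw [bump_eq_one (by linarith) (by linarith) hb ((distInt_sub_le u v).trans (by linarith)),
    one_mul]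
  exact mul_le_of_le_one_right (bump_nonneg _ _ _) (bump_le_one _ _ _)

theorem exists_abs_deriv_bump_div_le {s₁ s₂ : ℝ} (hs₁ : 0 ≤ s₁) (hs : s₁ < s₂) :
    ∃ K : ℝ, 0 ≤ K ∧ ∀ k : ℕ, 1 ≤ k → 4 * s₂ ≤ k ^ 5 →
      ∀ y, |deriv (bump (s₁ / k ^ 5) (s₂ / k ^ 5)) y| ≤ K * k ^ 10 := by
  obtain ⟨K, hK0, hK⟩ := exists_bound_deriv_bump
  have hsq : 0 < s₂ ^ 2 - s₁ ^ 2 := by nlinarith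
  refine ⟨K / (s₂ ^ 2 - s₁ ^ 2), by positivity, fun k hk hks y ↦ ?_⟩
  have hk0 : (0 : ℝ) < k := by exact_mod_cast hk
  refine (hK _ _ y (by positivity) (by gcongr) ?_).trans_eq ?_
  · rw [div_le_iff₀ (by positivity)]
    linarith
  · rw [show (s₂ / (k : ℝ) ^ 5) ^ 2 - (s₁ / k ^ 5) ^ 2 = (s₂ ^ 2 - s₁ ^ 2) / k ^ 10 by
      field_simp]
    field_simp

/-- The second moment of the centred, smoothly weighted number of pairs among the first `k ^ 5`
powers. -/
theorem exists_integral_sum_bump_sq_le {A B s₁ s₂ : ℝ} (hA : 1 < A) (hAB : A ≤ B) (hs₁ : 0 ≤ s₁)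
    (hs : s₁ < s₂) : ∃ C : ℝ, ∀ k : ℕ, 1 ≤ k → 12 * s₂ ≤ k ^ 5 →
      ∫ x in A..B, (∑ n ∈ Finset.Icc 1 (k ^ 5), ∑ m ∈ Finset.Ico 1 n,
        (bump (s₁ / k ^ 5) (s₂ / k ^ 5) (x ^ n - x ^ m) -
          ∫ t in (0 : ℝ)..1, bump (s₁ / k ^ 5) (s₂ / k ^ 5) t)) ^ 2 ≤ C * k ^ 8 := by
  have hs₂ : 0 < s₂ := hs₁.trans_lt hs
  have hBA := sub_nonneg.2 hAB
  obtain ⟨K₁, hK₁0, hK₁⟩ := exists_abs_deriv_bump_div_le hs₁ hs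
  obtain ⟨K₂, hK₂0, hK₂⟩ := exists_abs_deriv_bump_div_le (s₁ := 2 * s₂) (s₂ := 3 * s₂)
    (by linarith) (by linarith)
  obtain ⟨C, hC0, hC⟩ := exists_abs_integral_comp_mul_bump_sub_le hA hAB (K₁ + K₂) (by positivity)
  set c := C + 2 * s₂ + 6 * s₂ * (B - A) + 2 * s₂ * (C + 6 * s₂ * (B - A)) with hc
  have hc0 : 0 ≤ c := by positivity
  refine ⟨2 * ((B - A) + 10 * c + 2 * c ^ 2 * (B - A)) + C, fun k hk hks ↦ ?_⟩
  have hk1 : (1 : ℝ) ≤ k := by exact_mod_cast hk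
  have hk0 : (0 : ℝ) < k := by linarith
  set a := s₁ / (k : ℝ) ^ 5 with ha
  set b := s₂ / (k : ℝ) ^ 5 with hb
  have ha0 : 0 ≤ a := by positivity
  have hab : a < b := by simp only [ha, hb]; gcongr
  have hb3 : 3 * b ≤ 1 / 4 := by
    rw [hb, ← mul_div_assoc, div_le_iff₀ (by positivity)]
    linarith
  have hb0 : 0 < b := ha0.trans_lt hab
  set μ := ∫ t in (0 : ℝ)..1, bump a b t with hμ
  set ν := ∫ t in (0 : ℝ)..1, bump (2 * b) (3 * b) t with hν
  have hμ0 : 0 ≤ μ := integral_bump_nonneg _ _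
  have hμ1 : μ ≤ 1 := integral_bump_le_one _ _
  have hμb : μ ≤ 2 * b := integral_bump_le ha0 hab (by linarith)
  have hνb : ν ≤ 6 * b := by
    have := integral_bump_le (a := 2 * b) (b := 3 * b) (by linarith) (by linarith) hb3
    linarith
  have hK10 : (0 : ℝ) ≤ (k : ℝ) ^ 10 := by positivity
  have hderiv₁ (y : ℝ) : |deriv (bump a b) y| ≤ (K₁ + K₂) * k ^ 10 :=
    (hK₁ k hk (by linarith) y).trans (by nlinarith)
  have hderiv₂ (y : ℝ) : |deriv (bump (2 * b) (3 * b)) y| ≤ (K₁ + K₂) * k ^ 10 := by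
    have := hK₂ k hk (by linarith) y
    rw [mul_div_assoc, mul_div_assoc] at this
    exact this.trans (by nlinarith)
  have hcb (a' b' : ℝ) (m n : ℕ) : Continuous fun x : ℝ ↦ bump a' b' (x ^ n - x ^ m) := by
    have := continuous_bump a' b'
    fun_prop
  have hk12 (p : ℕ) (hp : p ≤ 12) : C / (k : ℝ) ^ 12 ≤ C / k ^ p := by gcongr
  have hmean (a' b' : ℝ) (m n : ℕ) (hkn : k < n) (hmn : m < n) :
      ∫ x in A..B, bump a' b' (x ^ n - x ^ m) ≤
        C / k ^ 5 + (∫ t in (0 : ℝ)..1, bump a' b' t) * (B - A) := by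
    have := hC k hk (fun _ ↦ 1) a' b' contDiff_const (by simp) (by simp; positivity) 0 1 m n
      one_pos hmn (by omega)
    simp only [one_mul] at this
    rw [intervalIntegral.integral_sub ((hcb a' b' m n).intervalIntegrable _ _) (by simp)] at this
    have h2 := (le_abs_self _).trans (this.trans (hk12 5 (by norm_num)))
    rw [intervalIntegral.integral_const, smul_eq_mul] at h2
    linarith
  refine integral_sum_sum_sub_sq_le hAB hc0 hC0 hk hμ0 hμ1 ?_ (fun m n ↦ hcb a b m n)
    (fun _ _ _ ↦ bump_nonneg _ _ _) (fun _ _ _ ↦ bump_le_one _ _ _) ?_ ?_ ?_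
  · refine hμb.trans ?_
    rw [hb, ← mul_div_assoc]
    gcongr
    have : 0 ≤ C + 6 * s₂ * (B - A) + 2 * s₂ * (C + 6 * s₂ * (B - A)) := by positivity
    linarith
  · intro m n hkn hmn
    refine (hmean a b m n hkn hmn).trans ?_
    calc C / k ^ 5 + μ * (B - A) ≤ C / k ^ 5 + 2 * b * (B - A) := by gcongr
      _ = (C + 2 * s₂ * (B - A)) / k ^ 5 := by rw [hb]; ring
      _ ≤ c / k ^ 5 := by
        gcongr
        have : 0 ≤ 2 * s₂ + 4 * s₂ * (B - A) + 2 * s₂ * (C + 6 * s₂ * (B - A)) := by positivity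
        linarith
  · intro m m' n hmm' hkm' hm'n
    have hG := hC k hk (bump (2 * b) (3 * b)) a b (contDiff_bump _ _)
      (fun y ↦ by rw [abs_of_nonneg (bump_nonneg _ _ _)]; exact bump_le_one _ _ _) hderiv₂
      m m' m n hmm' (by omega) hm'n
    have hG' := (le_abs_self _).trans (hG.trans (hk12 10 (by norm_num)))
    simp only [mul_sub] at hG'
    have hint (a' b' : ℝ) (i j i' j' : ℕ) : IntervalIntegrable
        (fun x ↦ bump a' b' (x ^ i - x ^ j) * bump a b (x ^ i' - x ^ j')) volume A B :=
      ((hcb a' b' j i).mul (hcb a b j' i')).intervalIntegrable _ _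
    rw [intervalIntegral.integral_sub (hint _ _ _ _ _ _)
      (((hcb _ _ _ _).intervalIntegrable _ _).mul_const _),
      intervalIntegral.integral_mul_const] at hG'
    have hpt : ∫ x in A..B, bump a b (x ^ n - x ^ m) * bump a b (x ^ n - x ^ m') ≤
        ∫ x in A..B, bump (2 * b) (3 * b) (x ^ m' - x ^ m) * bump a b (x ^ n - x ^ m) := by
      refine intervalIntegral.integral_mono_on hAB
        (hint _ _ _ _ _ _) (hint _ _ _ _ _ _) fun x _ ↦ ?_
      have := bump_mul_bump_le (u := x ^ n - x ^ m) (v := x ^ n - x ^ m') ha0 hab hb3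
      rwa [show x ^ n - x ^ m - (x ^ n - x ^ m') = x ^ m' - x ^ m by ring] at this
    have hI := hmean (2 * b) (3 * b) m m' hkm' hmm'
    have hI0 : 0 ≤ ∫ x in A..B, bump (2 * b) (3 * b) (x ^ m' - x ^ m) :=
      intervalIntegral.integral_nonneg hAB fun x _ ↦ bump_nonneg _ _ _
    have hI2 : (∫ x in A..B, bump (2 * b) (3 * b) (x ^ m' - x ^ m)) * μ ≤
        (C / k ^ 5 + 6 * b * (B - A)) * (2 * b) := by
      gcongr
      exact hI.trans (by gcongr)
    calc _ ≤ C / k ^ 10 + (C / k ^ 5 + 6 * b * (B - A)) * (2 * b) := by linarith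
      _ = (C + 2 * s₂ * (C + 6 * s₂ * (B - A))) / (k ^ 5) ^ 2 := by
        rw [hb]
        field_simp
      _ ≤ c / (k ^ 5) ^ 2 := by
        gcongr
        have : 0 ≤ 2 * s₂ + 6 * s₂ * (B - A) := by positivity
        linarith
  · intro m n m' n' hmn hmn' hnn'
    refine hC k hk (fun y ↦ bump a b y - μ) a b ((contDiff_bump a b).sub contDiff_const)
      (fun y ↦ abs_sub_le_one_of_mem (bump_nonneg _ _ _) (bump_le_one _ _ _) hμ0 hμ1)
      (fun y ↦ ?_) m n m' n' hmn hmn' hnn'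
    rw [deriv_sub_const]
    exact hderiv₁ y

theorem ae_tendsto_zero_of_integral_sq_le {A B D : ℝ} (hAB : A ≤ B) {F : ℕ → ℝ → ℝ}
    (hF : ∀ k, Continuous (F k)) {k₀ : ℕ}
    (hle : ∀ k, k₀ ≤ k → ∫ x in A..B, F k x ^ 2 ≤ D / k ^ 2) :
    ∀ᵐ x ∂(volume.restrict (Set.Ioc A B)), Tendsto (fun k ↦ F k x) atTop (nhds 0) := by
  have hmeas (k : ℕ) : Measurable fun x ↦ ENNReal.ofReal (F (k + k₀) x ^ 2) :=
    ((hF _).pow 2).measurable.ennreal_ofReal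
  have hlint (k : ℕ) : ∫⁻ x in Set.Ioc A B, ENNReal.ofReal (F (k + k₀) x ^ 2) ≤
      ENNReal.ofReal (D / ((k + k₀ : ℕ) : ℝ) ^ 2) := by
    rw [← ofReal_integral_eq_lintegral_ofReal, ← intervalIntegral.integral_of_le hAB]
    · exact ENNReal.ofReal_le_ofReal (hle _ (Nat.le_add_left _ _))
    · exact (((hF _).pow 2).intervalIntegrable A B).1
    · exact ae_of_all _ fun x ↦ sq_nonneg _
  have hsum : Summable fun k : ℕ ↦ D / ((k + k₀ : ℕ) : ℝ) ^ 2 := by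
    have h := (Real.summable_nat_pow_inv.2 one_lt_two).mul_left D
    simp_rw [← div_eq_mul_inv] at h
    exact (summable_nat_add_iff k₀).2 h
  have hfin : ∫⁻ x in Set.Ioc A B, ∑' k, ENNReal.ofReal (F (k + k₀) x ^ 2) ≠ ⊤ := by
    rw [lintegral_tsum fun k ↦ (hmeas k).aemeasurable]
    exact ne_top_of_le_ne_top hsum.tsum_ofReal_ne_top (ENNReal.tsum_le_tsum hlint)
  filter_upwards [ae_lt_top (Measurable.tsum hmeas) hfin] with x hx
  have h1 := ENNReal.tendsto_atTop_zero_of_tsum_ne_top hx.ne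
  have h2 := (ENNReal.tendsto_toReal ENNReal.zero_ne_top).comp h1
  have h3 : Tendsto (fun k ↦ F (k + k₀) x ^ 2) atTop (nhds 0) := by
    simpa [Function.comp_def, ENNReal.toReal_ofReal (sq_nonneg _)] using h2
  have h4 := h3.sqrt
  simp only [Real.sqrt_sq_eq_abs, Real.sqrt_zero] at h4
  exact (tendsto_add_atTop_iff_nat k₀).1 ((tendsto_zero_iff_abs_tendsto_zero _).2 h4)

/-- The average deviation, over the first `k ^ 5` powers of `x`, of the smoothly weighted number
of pairs from its expected value. -/
noncomputable def deviation (s₁ s₂ : ℝ) (k : ℕ) (x : ℝ) : ℝ :=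
  (∑ n ∈ Finset.Icc 1 (k ^ 5), ∑ m ∈ Finset.Ico 1 n,
    (bump (s₁ / k ^ 5) (s₂ / k ^ 5) (x ^ n - x ^ m) -
      ∫ t in (0 : ℝ)..1, bump (s₁ / k ^ 5) (s₂ / k ^ 5) t)) / k ^ 5

theorem eventually_le_pow_five (t : ℝ) : ∀ᶠ k : ℕ in atTop, t ≤ (k : ℝ) ^ 5 :=
  ((tendsto_pow_atTop (by norm_num)).comp tendsto_natCast_atTop_atTop).eventually_ge_atTop t

theorem ae_tendsto_deviation {A B s₁ s₂ : ℝ} (hA : 1 < A) (hAB : A ≤ B) (hs₁ : 0 ≤ s₁)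
    (hs : s₁ < s₂) : ∀ᵐ x ∂(volume.restrict (Set.Ioc A B)),
      Tendsto (fun k ↦ deviation s₁ s₂ k x) atTop (nhds 0) := by
  obtain ⟨C, hC⟩ := exists_integral_sum_bump_sq_le hA hAB hs₁ hs
  obtain ⟨k₀, hk₀⟩ := eventually_atTop.1
    ((eventually_le_pow_five (12 * s₂)).and (eventually_ge_atTop 1))
  refine ae_tendsto_zero_of_integral_sq_le (D := C) (k₀ := k₀) hAB (fun k ↦ ?_) fun k hk ↦ ?_
  · have := continuous_bump (s₁ / k ^ 5) (s₂ / k ^ 5)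
    unfold deviation
    fun_prop
  · obtain ⟨h1, h2⟩ := hk₀ k hk
    have hk0 : (0 : ℝ) < k := by exact_mod_cast h2
    simp only [deviation, div_pow]
    rw [intervalIntegral.integral_div, div_le_iff₀ (by positivity)]
    refine (hC k h2 h1).trans_eq ?_
    field_simp

theorem cast_pairCount (x s : ℝ) (N : ℕ) :
    (pairCount x s N : ℝ) = 2 * ∑ n ∈ Finset.Icc 1 N, ∑ m ∈ Finset.Ico 1 n,
      Set.indicator {y | distInt y ≤ s / N} (fun _ ↦ (1 : ℝ)) (x ^ n - x ^ m) := by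
  classical
  set φ : ℕ → ℕ → ℝ := fun n m ↦
    Set.indicator {y | distInt y ≤ s / N} (fun _ ↦ (1 : ℝ)) (x ^ n - x ^ m) with hφ
  have hsymm (n m : ℕ) : φ n m = φ m n := by
    simp only [hφ, Set.indicator, Set.mem_ofPred_eq]
    rw [← distInt_neg, neg_sub]
  have hlt : ∑ n ∈ Finset.Icc 1 N, ∑ m ∈ Finset.Ico 1 n, φ n m =
      ∑ n ∈ Finset.Icc 1 N, ∑ m ∈ Finset.Icc 1 N, if m < n then φ n m else 0 := by
    refine Finset.sum_congr rfl fun n hn ↦ ?_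
    rw [← Finset.sum_filter]
    refine Finset.sum_congr ?_ fun _ _ ↦ rfl
    ext m
    simp only [Finset.mem_filter, Finset.mem_Icc, Finset.mem_Ico] at hn ⊢
    omega
  have hgt : ∑ n ∈ Finset.Icc 1 N, ∑ m ∈ Finset.Ico 1 n, φ n m =
      ∑ n ∈ Finset.Icc 1 N, ∑ m ∈ Finset.Icc 1 N, if n < m then φ n m else 0 := by
    rw [hlt, Finset.sum_comm]
    simp_rw [hsymm]
  rw [two_mul]
  nth_rewrite 1 [hlt]
  rw [hgt, ← Finset.sum_add_distrib, pairCount, Finset.natCast_card_filter, Finset.sum_product,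
    Finset.sum_comm]
  refine Finset.sum_congr rfl fun n _ ↦ ?_
  rw [← Finset.sum_add_distrib]
  refine Finset.sum_congr rfl fun m _ ↦ ?_
  rcases lt_trichotomy m n with h | h | h
  · simp [h, h.ne, h.not_gt, hφ, Set.indicator, distInt]
    congr
  · simp [h]
  · simp [h, h.ne', h.not_gt, hφ, Set.indicator, distInt]
    congr

theorem sum_card_Ico (N : ℕ) :
    ∑ n ∈ Finset.Icc 1 N, ((Finset.Ico 1 n).card : ℝ) = N * (N - 1) / 2 := by
  induction N with
  | zero => simp
  | succ N ih =>
    rw [Finset.sum_Icc_succ_top (by omega), ih, Nat.card_Ico]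
    push_cast
    simp
    ring

theorem sum_bump_eq {s₁ s₂ : ℝ} {k : ℕ} (hk : 1 ≤ k) (x : ℝ) :
    2 * ∑ n ∈ Finset.Icc 1 (k ^ 5), ∑ m ∈ Finset.Ico 1 n,
      bump (s₁ / k ^ 5) (s₂ / k ^ 5) (x ^ n - x ^ m) =
    (2 * deviation s₁ s₂ k x +
      (k ^ 5 - 1) * ∫ t in (0 : ℝ)..1, bump (s₁ / k ^ 5) (s₂ / k ^ 5) t) * k ^ 5 := by
  have hk0 : (0 : ℝ) < k := by exact_mod_cast hk
  simp only [deviation, Finset.sum_sub_distrib, Finset.sum_const, nsmul_eq_mul, ← Finset.sum_mul]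
  rw [sum_card_Ico]
  push_cast
  field_simp
  ring

theorem pairCount_le {s₁ s₂ : ℝ} {k : ℕ} (hs₁ : 0 ≤ s₁) (hs : s₁ < s₂) (hk : 1 ≤ k)
    (hks : 4 * s₂ ≤ (k : ℝ) ^ 5) (x : ℝ) :
    (pairCount x s₁ (k ^ 5) : ℝ) ≤ (2 * deviation s₁ s₂ k x + 2 * s₂) * k ^ 5 := by
  have hk1 : (1 : ℝ) ≤ k := by exact_mod_cast hk
  have hk5 : (1 : ℝ) ≤ (k : ℝ) ^ 5 := one_le_pow₀ hk1
  have ha : 0 ≤ s₁ / (k : ℝ) ^ 5 := by positivity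
  have hab : s₁ / (k : ℝ) ^ 5 < s₂ / (k : ℝ) ^ 5 := by gcongr
  have hb : s₂ / (k : ℝ) ^ 5 ≤ 1 / 4 := by
    rw [div_le_iff₀ (by positivity)]
    linarith
  have hμ := integral_bump_le ha hab hb
  calc (pairCount x s₁ (k ^ 5) : ℝ) ≤ 2 * ∑ n ∈ Finset.Icc 1 (k ^ 5), ∑ m ∈ Finset.Ico 1 n,
        bump (s₁ / k ^ 5) (s₂ / k ^ 5) (x ^ n - x ^ m) := by
        rw [cast_pairCount]
        gcongr
        refine Set.indicator_apply_le' (fun h ↦ ?_) fun _ ↦ bump_nonneg _ _ _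
        rw [Set.mem_ofPred_eq, Nat.cast_pow] at h
        exact (bump_eq_one ha hab hb h).ge
    _ = _ := sum_bump_eq hk x
    _ ≤ (2 * deviation s₁ s₂ k x + k ^ 5 * (2 * (s₂ / k ^ 5))) * k ^ 5 := by
        gcongr
        · exact integral_bump_nonneg _ _
        · linarith
    _ = _ := by field_simp

theorem le_pairCount {s₁ s₂ : ℝ} {k : ℕ} (hs₁ : 0 ≤ s₁) (hs : s₁ < s₂) (hk : 1 ≤ k)
    (hks : 4 * s₂ ≤ (k : ℝ) ^ 5) (x : ℝ) :
    (2 * deviation s₁ s₂ k x + 2 * s₁ - 2 * s₁ / k ^ 5) * k ^ 5 ≤ pairCount x s₂ (k ^ 5) := by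
  have hk1 : (1 : ℝ) ≤ k := by exact_mod_cast hk
  have hk5 : (1 : ℝ) ≤ (k : ℝ) ^ 5 := one_le_pow₀ hk1
  have ha : 0 ≤ s₁ / (k : ℝ) ^ 5 := by positivity
  have hab : s₁ / (k : ℝ) ^ 5 < s₂ / (k : ℝ) ^ 5 := by gcongr
  have hb : s₂ / (k : ℝ) ^ 5 ≤ 1 / 4 := by
    rw [div_le_iff₀ (by positivity)]
    linarith
  have hμ := le_integral_bump ha hab hb
  calc (2 * deviation s₁ s₂ k x + 2 * s₁ - 2 * s₁ / k ^ 5) * k ^ 5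
      = (2 * deviation s₁ s₂ k x + (k ^ 5 - 1) * (2 * (s₁ / k ^ 5))) * k ^ 5 := by
        field_simp
        ring
    _ ≤ (2 * deviation s₁ s₂ k x +
      (k ^ 5 - 1) * ∫ t in (0 : ℝ)..1, bump (s₁ / k ^ 5) (s₂ / k ^ 5) t) * k ^ 5 := by
        gcongr
    _ = _ := (sum_bump_eq hk x).symm
    _ ≤ _ := by
        rw [cast_pairCount]
        gcongr
        refine Set.le_indicator_apply (fun _ ↦ bump_le_one _ _ _) fun h ↦ ?_
        rw [Set.mem_ofPred_eq, Nat.cast_pow, not_le] at h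
        exact (bump_eq_zero ha hab hb h.le).le

theorem pairCount_mono {x s s' : ℝ} {N N' : ℕ} (hN : N ≤ N') (hs : s / N ≤ s' / N') :
    pairCount x s N ≤ pairCount x s' N' := by
  classical
  refine Finset.card_le_card fun p hp ↦ ?_
  simp only [Finset.mem_filter, Finset.mem_product, Finset.mem_Icc] at hp ⊢
  exact ⟨by omega, hp.2.1, hp.2.2.trans hs⟩

theorem exists_pow_five_le_lt {K N : ℕ} (h : K ^ 5 ≤ N) :
    ∃ k, K ≤ k ∧ k ^ 5 ≤ N ∧ N < (k + 1) ^ 5 := by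
  have hK : K ≤ N := (Nat.le_self_pow (by norm_num) K).trans h
  refine ⟨Nat.findGreatest (fun k ↦ k ^ 5 ≤ N) N, Nat.le_findGreatest hK h,
    Nat.findGreatest_spec (P := fun k ↦ k ^ 5 ≤ N) hK h, ?_⟩
  by_contra! hle
  have := Nat.le_findGreatest (P := fun k ↦ k ^ 5 ≤ N)
    ((Nat.le_self_pow (by norm_num) _).trans hle) hle
  omega

theorem tendsto_succ_pow_five_div :
    Tendsto (fun k : ℕ ↦ ((k : ℝ) + 1) ^ 5 / (k : ℝ) ^ 5) atTop (nhds 1) := by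
  have h := (tendsto_one_div_atTop_nhds_zero_nat (𝕜 := ℝ)).const_add 1 |>.pow 5
  rw [add_zero, one_pow] at h
  refine h.congr' ?_
  filter_upwards [eventually_gt_atTop 0] with k hk
  have : (0 : ℝ) < k := by exact_mod_cast hk
  rw [← div_pow]
  congr 1
  field_simp

theorem tendsto_pairCount_div {x : ℝ} (hx : ∀ q₁ q₂ : ℚ, 0 ≤ q₁ → q₁ < q₂ →
      Tendsto (fun k ↦ deviation q₁ q₂ k x) atTop (nhds 0)) {s : ℝ} (hs : 0 < s) :
    Tendsto (fun N : ℕ ↦ (pairCount x s N : ℝ) / N) atTop (nhds (2 * s)) := by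
  have hupper {t u : ℝ} (ht : 0 ≤ t) (htu : t < u) :
      ∀ᶠ k : ℕ in atTop, (pairCount x t (k ^ 5) : ℝ) ≤ 2 * u * k ^ 5 := by
    obtain ⟨q₁, h1, h1u⟩ := exists_rat_btwn htu
    obtain ⟨q₂, h2, h2u⟩ := exists_rat_btwn h1u
    have hq1 : (0 : ℝ) ≤ q₁ := ht.trans h1.le
    have hd := (hx q₁ q₂ (by exact_mod_cast hq1) (by exact_mod_cast h2)).eventually_le_const
      (sub_pos.2 h2u)
    filter_upwards [hd, eventually_le_pow_five (4 * q₂), eventually_ge_atTop 1] with k hk hk2 hk1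
    calc (pairCount x t (k ^ 5) : ℝ) ≤ pairCount x q₁ (k ^ 5) := by
          exact_mod_cast pairCount_mono le_rfl (by gcongr)
      _ ≤ (2 * deviation q₁ q₂ k x + 2 * q₂) * k ^ 5 := pairCount_le hq1 h2 hk1 hk2 x
      _ ≤ _ := by
        gcongr
        linarith
  have hlower {l t : ℝ} (hl : 0 ≤ l) (hlt : l < t) :
      ∀ᶠ k : ℕ in atTop, 2 * l * k ^ 5 ≤ (pairCount x t (k ^ 5) : ℝ) := by
    obtain ⟨q₁, h1, h1t⟩ := exists_rat_btwn hlt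
    obtain ⟨q₂, h2, h2t⟩ := exists_rat_btwn h1t
    have hq1 : (0 : ℝ) ≤ q₁ := hl.trans h1.le
    have hd := (hx q₁ q₂ (by exact_mod_cast hq1) (by exact_mod_cast h2)).eventually_const_le
      (show -((q₁ - l) / 2) < 0 by linarith)
    filter_upwards [hd, eventually_le_pow_five (4 * q₂),
      eventually_le_pow_five (2 * q₁ / (q₁ - l)), eventually_ge_atTop 1] with k hk hk2 hk3 hk1
    have hk0 : (0 : ℝ) < k := by exact_mod_cast hk1
    have h3 : 2 * q₁ / (k : ℝ) ^ 5 ≤ q₁ - l := by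
      rw [div_le_iff₀ (by linarith)] at hk3
      rw [div_le_iff₀ (by positivity)]
      linarith
    calc 2 * l * (k : ℝ) ^ 5 ≤ (2 * deviation q₁ q₂ k x + 2 * q₁ - 2 * q₁ / k ^ 5) * k ^ 5 := by
          gcongr
          linarith
      _ ≤ (pairCount x q₂ (k ^ 5) : ℝ) := le_pairCount hq1 h2 hk1 hk2 x
      _ ≤ (pairCount x t (k ^ 5) : ℝ) := by
          exact_mod_cast pairCount_mono le_rfl (by gcongr)
  rw [tendsto_order]
  constructor
  · intro a ha
    obtain ⟨l, hl, hls⟩ := exists_between (show max (a / 2) 0 < s from max_lt (by linarith) hs)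
    obtain ⟨t, hlt, hts⟩ := exists_between hls
    obtain ⟨hal, hl0⟩ := max_lt_iff.1 hl
    have hρt := (tendsto_succ_pow_five_div.const_mul t).eventually_le_const
      (by rwa [mul_one] : t * 1 < s)
    have hρa := (tendsto_succ_pow_five_div.const_mul a).eventually_lt_const
      (by linarith : a * 1 < 2 * l)
    obtain ⟨K, hK⟩ := eventually_atTop.1
      (hρt.and (hρa.and ((hlower hl0.le hlt).and (eventually_ge_atTop 1))))
    filter_upwards [eventually_ge_atTop (K ^ 5)] with N hN
    obtain ⟨k, hKk, hkN, hNk⟩ := exists_pow_five_le_lt hN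
    obtain ⟨h1, h2, h3, h4⟩ := hK k hKk
    have hk0 : (0 : ℝ) < k := by exact_mod_cast h4
    have hkN' : (k : ℝ) ^ 5 ≤ N := by exact_mod_cast hkN
    have hNk' : (N : ℝ) ≤ ((k : ℝ) + 1) ^ 5 := by exact_mod_cast hNk.le
    have hk5 : (0 : ℝ) < (k : ℝ) ^ 5 := by positivity
    have hN0 : (0 : ℝ) < N := hk5.trans_le hkN'
    rw [← mul_div_assoc, div_le_iff₀ hk5] at h1
    rw [← mul_div_assoc, div_lt_iff₀ hk5] at h2
    have hmono : (pairCount x t (k ^ 5) : ℝ) ≤ pairCount x s N := by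
      refine Nat.cast_le.2 (pairCount_mono hkN ?_)
      rw [Nat.cast_pow, div_le_div_iff₀ hk5 hN0]
      exact (mul_le_mul_of_nonneg_left hNk' (hl0.trans hlt).le).trans h1
    rw [lt_div_iff₀ hN0]
    refine lt_of_lt_of_le ?_ (h3.trans hmono)
    rcases le_total a 0 with ha0 | ha0
    · exact (mul_nonpos_of_nonpos_of_nonneg ha0 hN0.le).trans_lt (by positivity)
    · exact (mul_le_mul_of_nonneg_left hNk' ha0).trans_lt h2
  · intro b hb
    obtain ⟨u, hsu, hub⟩ := exists_between (show s < b / 2 by linarith)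
    obtain ⟨t, hst, htu⟩ := exists_between hsu
    have hρt := (tendsto_succ_pow_five_div.const_mul s).eventually_le_const
      (by rwa [mul_one] : s * 1 < t)
    have hρb := (tendsto_succ_pow_five_div.const_mul (2 * u)).eventually_lt_const
      (by linarith : 2 * u * 1 < b)
    obtain ⟨K, hK⟩ := eventually_atTop.1
      (hρt.and (hρb.and (((tendsto_add_atTop_nat 1).eventually
        (hupper (hs.trans hst).le htu)).and (eventually_ge_atTop 1))))
    filter_upwards [eventually_ge_atTop (K ^ 5)] with N hN
    obtain ⟨k, hKk, hkN, hNk⟩ := exists_pow_five_le_lt hN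
    obtain ⟨h1, h2, h3, h4⟩ := hK k hKk
    have hk0 : (0 : ℝ) < k := by exact_mod_cast h4
    have hkN' : (k : ℝ) ^ 5 ≤ N := by exact_mod_cast hkN
    have hk5 : (0 : ℝ) < (k : ℝ) ^ 5 := by positivity
    have hN0 : (0 : ℝ) < N := hk5.trans_le hkN'
    rw [← mul_div_assoc, div_le_iff₀ hk5] at h1
    rw [← mul_div_assoc, div_lt_iff₀ hk5] at h2
    have ht0 : 0 ≤ t := (hs.trans hst).le
    have hb0 : 0 ≤ b := by linarith
    have hmono : (pairCount x s N : ℝ) ≤ pairCount x t ((k + 1) ^ 5) := by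
      refine Nat.cast_le.2 (pairCount_mono hNk.le ?_)
      push_cast
      rw [div_le_div_iff₀ hN0 (by positivity)]
      exact h1.trans (mul_le_mul_of_nonneg_left hkN' ht0)
    rw [div_lt_iff₀ hN0]
    push_cast at h3
    exact (hmono.trans h3).trans_lt (h2.trans_le (mul_le_mul_of_nonneg_left hkN' hb0))

theorem Ioi_one_subset_iUnion_Ioc :
    Set.Ioi (1 : ℝ) ⊆ ⋃ j : ℕ, Set.Ioc (1 + 1 / ((j : ℝ) + 1)) (j + 2) := by
  intro x hx
  rw [Set.mem_Ioi] at hx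
  obtain ⟨i, hi⟩ := exists_nat_one_div_lt (sub_pos.2 hx)
  obtain ⟨j, hj⟩ := exists_nat_ge x
  refine Set.mem_iUnion.2 ⟨max i j, ?_, ?_⟩
  · have : 1 / (((max i j : ℕ) : ℝ) + 1) ≤ 1 / ((i : ℝ) + 1) := by
      gcongr
      exact le_max_left i j
    linarith
  · have : (j : ℝ) ≤ (max i j : ℕ) := by exact_mod_cast le_max_right i j
    linarith

end PairCorrelation

/-- For Lebesgue almost every `x > 1`, the sequence of fractional parts of `x^n`
has Poissonian pair correlations. -/
theorem ae_poissonian_pair_correlations_of_powers :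
    ∀ᵐ x ∂(volume.restrict (Set.Ioi (1 : ℝ))),
      ∀ s : ℝ, 0 < s →
        Tendsto (fun N : ℕ => (pairCount x s N : ℝ) / N) atTop (nhds (2 * s)) := by
  have hdev : ∀ᵐ x ∂(volume.restrict (⋃ j : ℕ, Set.Ioc (1 + 1 / ((j : ℝ) + 1)) (j + 2))),
      ∀ q₁ q₂ : ℚ, 0 ≤ q₁ → q₁ < q₂ →
        Tendsto (fun k ↦ PairCorrelation.deviation q₁ q₂ k x) atTop (nhds 0) := by
    rw [ae_restrict_iUnion_iff]
    intro j
    simp_rw [ae_all_iff]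
    intro q₁ q₂ h1 h2
    refine PairCorrelation.ae_tendsto_deviation ?_ ?_ (by exact_mod_cast h1) (by exact_mod_cast h2)
    · have : (0 : ℝ) < 1 / ((j : ℝ) + 1) := by positivity
      linarith
    · have h3 : 1 / ((j : ℝ) + 1) ≤ 1 := by
        rw [div_le_one (by positivity)]
        have : (0 : ℝ) ≤ j := by positivity
        linarith
      have : (0 : ℝ) ≤ j := by positivity
      linarith
  filter_upwards [ae_restrict_of_ae_restrict_of_subset
    PairCorrelation.Ioi_one_subset_iUnion_Ioc hdev] with x hx s hs
  exact PairCorrelation.tendsto_pairCount_div hx hs
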